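/- Let R be a commutative Noetherian ring of prime characteristic p > 0, let I, 𝔞 ⊆ R be ideals, and let t ∈ ℚ with t > 0. Then the Hara–Yoshida 𝔞ᵗ-tight closure is contained in the colon of the tight closure by the t-th rational power of 𝔞: I^{*𝔞ᵗ} ⊆ (I* : 𝔞ₜ). -/

import Mathlib

open Ideal Filter
open scoped Pointwise

/-- `R°`: the set of elements of `R` not contained in any minimal prime of `R`. -/
def Rcirc (R : Type*) [CommRing R] : Set R :=
  {c | ∀ P ∈ minimalPrimes R, c ∉ P}

/-- The integral closure of an ideal `I`: elements satisfying an equation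
`x^n + r₁ x^{n-1} + ⋯ + rₙ = 0` with `rᵢ ∈ Iⁱ`. -/
def intCl {R : Type*} [CommRing R] (I : Ideal R) : Set R :=
  {x | ∃ n : ℕ, 0 < n ∧ ∃ r : ℕ → R,
    (∀ i, 1 ≤ i → i ≤ n → r i ∈ I ^ i) ∧
    x ^ n + ∑ i ∈ Finset.range n, r (i + 1) * x ^ (n - (i + 1)) = 0}

/-- The Hara–Yoshida `𝔞^t`-integral closure of `I`. -/
def HYIntCl {R : Type*} [CommRing R] (I a : Ideal R) (t : ℝ) : Set R :=
  {x | ∃ c ∈ Rcirc R, ∃ N : ℕ, ∀ n : ℕ, N ≤ n →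
    ∀ y ∈ a ^ ⌈t * (n : ℝ)⌉₊, c * x ^ n * y ∈ I ^ n}

/-- The Vraciu `𝔞^t`-integral closure of `I`. -/
def VIntCl {R : Type*} [CommRing R] (I a : Ideal R) (t : ℝ) : Set R :=
  {x | ∃ c ∈ Rcirc R, ∃ N : ℕ, ∀ n : ℕ, N ≤ n →
    ∀ y ∈ a ^ ⌈t * (n : ℝ)⌉₊, c * x ^ n * y ∈ a ^ ⌈t * (n : ℝ)⌉₊ * I ^ n}

/-- The `q`-th Frobenius bracket power `I^{[q]}`: the ideal generated by `q`-th powers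
of elements of `I`. -/
def fbp {R : Type*} [CommRing R] (I : Ideal R) (q : ℕ) : Ideal R :=
  Ideal.span ((fun x => x ^ q) '' (I : Set R))

/-- The Frobenius closure `I^F` (in characteristic `p`). -/
def frobCl {R : Type*} [CommRing R] (p : ℕ) (I : Ideal R) : Set R :=
  {x | ∃ e : ℕ, x ^ p ^ e ∈ fbp I (p ^ e)}

/-- The tight closure `I^*` (in characteristic `p`). -/
def tightCl {R : Type*} [CommRing R] (p : ℕ) (I : Ideal R) : Set R :=
  {x | ∃ c ∈ Rcirc R, ∃ E : ℕ, ∀ e : ℕ, E ≤ e → c * x ^ p ^ e ∈ fbp I (p ^ e)}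

/-- The Hara–Yoshida `𝔞^t`-Frobenius closure of `I`. -/
def HYFrobCl {R : Type*} [CommRing R] (p : ℕ) (I a : Ideal R) (t : ℝ) : Set R :=
  {x | ∃ E : ℕ, ∀ e : ℕ, E ≤ e →
    ∀ y ∈ a ^ ⌈t * (p : ℝ) ^ e⌉₊, x ^ p ^ e * y ∈ fbp I (p ^ e)}

/-- The Vraciu `𝔞^t`-Frobenius closure of `I`. -/
def VFrobCl {R : Type*} [CommRing R] (p : ℕ) (I a : Ideal R) (t : ℝ) : Set R :=
  {x | ∃ E : ℕ, ∀ e : ℕ, E ≤ e →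
    ∀ y ∈ a ^ ⌈t * (p : ℝ) ^ e⌉₊, x ^ p ^ e * y ∈ a ^ ⌈t * (p : ℝ) ^ e⌉₊ * fbp I (p ^ e)}

/-- The Hara–Yoshida `𝔞^t`-tight closure of `I`. -/
def HYTightCl {R : Type*} [CommRing R] (p : ℕ) (I a : Ideal R) (t : ℝ) : Set R :=
  {x | ∃ c ∈ Rcirc R, ∃ E : ℕ, ∀ e : ℕ, E ≤ e →
    ∀ y ∈ a ^ ⌈t * (p : ℝ) ^ e⌉₊, c * x ^ p ^ e * y ∈ fbp I (p ^ e)}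

/-- The Vraciu `𝔞^t`-tight closure of `I`. -/
def VTightCl {R : Type*} [CommRing R] (p : ℕ) (I a : Ideal R) (t : ℝ) : Set R :=
  {x | ∃ c ∈ Rcirc R, ∃ E : ℕ, ∀ e : ℕ, E ≤ e →
    ∀ y ∈ a ^ ⌈t * (p : ℝ) ^ e⌉₊, c * x ^ p ^ e * y ∈ a ^ ⌈t * (p : ℝ) ^ e⌉₊ * fbp I (p ^ e)}

/-- The `t`-th rational power of an ideal `𝔞`, for `t = num/den ∈ ℚ`. -/
def ratPow {R : Type*} [CommRing R] (a : Ideal R) (t : ℚ) : Set R :=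
  {x | x ^ t.den ∈ intCl (a ^ t.num.toNat)}

/-- `μ(𝔞)`: the minimal number of generators of the ideal `𝔞`. -/
noncomputable def mu {R : Type*} [CommRing R] (a : Ideal R) : ℕ :=
  sInf {m | ∃ s : Finset R, s.card = m ∧ Ideal.span (s : Set R) = a}

/-- Powers of an element integral over `J` lie in powers of `J`, up to a bounded shift. -/
theorem exists_pow_mem_pow_sub_of_mem_intCl {R : Type*} [CommRing R] {J : Ideal R} {z : R}
    (hz : z ∈ intCl J) : ∃ n : ℕ, ∀ m : ℕ, z ^ m ∈ J ^ (m - n) := by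
  obtain ⟨n, -, r, hr, heq⟩ := hz
  refine ⟨n, fun m => ?_⟩
  induction m using Nat.strong_induction_on with
  | _ m ih =>
    rcases le_or_gt n m with hnm | hmn
    · have hzm : z ^ m = -∑ i ∈ Finset.range n, r (i + 1) * z ^ (m - (i + 1)) := by
        have hsum : ∑ i ∈ Finset.range n, r (i + 1) * z ^ (m - (i + 1)) =
            z ^ (m - n) * ∑ i ∈ Finset.range n, r (i + 1) * z ^ (n - (i + 1)) := by
          rw [Finset.mul_sum]
          refine Finset.sum_congr rfl fun i hi => ?_
          have hi' := Finset.mem_range.mp hi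
          rw [show m - (i + 1) = (m - n) + (n - (i + 1)) by omega, pow_add]
          ring
        have hpow : z ^ m = z ^ (m - n) * z ^ n := by
          rw [← pow_add, Nat.sub_add_cancel hnm]
        rw [hsum, hpow]
        linear_combination z ^ (m - n) * heq
      rw [hzm]
      refine neg_mem (sum_mem fun i hi => ?_)
      have hi' := Finset.mem_range.mp hi
      have hmem := Ideal.mul_mem_mul (hr (i + 1) (by omega) (by omega))
        (ih (m - (i + 1)) (by omega))
      rw [← pow_add] at hmem
      exact Ideal.pow_le_pow_right (by omega) hmem
    · simp [Nat.sub_eq_zero_of_le hmn.le]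

/-- An element of a minimal prime `P` has a power killed by an element outside `P`. -/
theorem exists_notMem_mul_pow_eq_zero {R : Type*} [CommRing R] {P : Ideal R}
    (hP : P ∈ minimalPrimes R) {y : R} (hy : y ∈ P) : ∃ b ∉ P, ∃ k : ℕ, b * y ^ k = 0 := by
  by_contra! h
  have : P.IsPrime := hP.isPrime
  have hdisj : Disjoint ((⊥ : Ideal R) : Set R)
      (P.primeCompl ⊔ Submonoid.powers y : Submonoid R) := by
    rw [Set.disjoint_left]
    rintro _ h0 hw
    obtain ⟨b, hb, _, ⟨k, rfl⟩, rfl⟩ := Submonoid.mem_sup.mp hw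
    exact h b hb k h0
  obtain ⟨Q, hQ, -, hQd⟩ := Ideal.exists_le_prime_disjoint _ _ hdisj
  rw [Set.disjoint_left] at hQd
  have hQP : Q ≤ P := fun w hw => by
    by_contra hwP
    exact hQd hw (Submonoid.mem_sup_left hwP)
  exact hQd (hP.2 ⟨hQ, bot_le⟩ hQP hy) (Submonoid.mem_sup_right (Submonoid.mem_powers y))

theorem mul_mem_Rcirc {R : Type*} [CommRing R] {c d : R} (hc : c ∈ Rcirc R) (hd : d ∈ Rcirc R) :
    c * d ∈ Rcirc R := fun P hP h =>
  ((hP.isPrime).mem_or_mem h).elim (hc P hP) (hd P hP)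

/-- An ideal of a Noetherian ring not contained in any minimal prime meets `R°`. -/
theorem exists_mem_Rcirc {R : Type*} [CommRing R] [IsNoetherianRing R] {K : Ideal R}
    (hK : ∀ P ∈ minimalPrimes R, ¬ K ≤ P) : ∃ c ∈ K, c ∈ Rcirc R := by
  have hfin := minimalPrimes.finite_of_isNoetherianRing R
  by_contra! h
  have hsub : (K : Set R) ⊆ ⋃ P ∈ (hfin.toFinset : Set (Ideal R)), (P : Set R) := fun c hc => by
    have hc' := h c hc
    simp only [Rcirc, Set.mem_ofPred_eq, not_forall, not_not] at hc'
    obtain ⟨P, hP, hcP⟩ := hc'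
    simp only [Set.mem_iUnion]
    exact ⟨P, by simpa using hP, hcP⟩
  obtain ⟨P, hP, hKP⟩ := (Ideal.subset_union_prime (f := id) ⊥ ⊥ fun P hP _ _ =>
    (hfin.mem_toFinset.mp hP).isPrime).mp hsub
  exact hK P (hfin.mem_toFinset.mp hP) hKP

/-- If every minimal prime containing `𝔞` contains `y`, then some element of `R°` multiplies all
large powers of `y` as an element of `𝔞 ^ N` does. -/
theorem exists_mem_Rcirc_mul_pow_eq {R : Type*} [CommRing R] [IsNoetherianRing R] {a : Ideal R}
    {y : R} (hy : ∀ P ∈ minimalPrimes R, a ≤ P → y ∈ P) (N : ℕ) :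
    ∃ c ∈ Rcirc R, ∃ d ∈ a ^ N, ∃ k : ℕ, ∀ m, k ≤ m → c * y ^ m = d * y ^ m := by
  have hker (b : R) : b ∈ RingHom.ker (algebraMap R (Localization.Away y)) ↔
      ∃ k : ℕ, b * y ^ k = 0 := by
    rw [RingHom.mem_ker, IsLocalization.map_eq_zero_iff (Submonoid.powers y)]
    constructor
    · rintro ⟨⟨_, k, rfl⟩, h⟩
      exact ⟨k, by rw [mul_comm]; exact h⟩
    · rintro ⟨k, h⟩
      exact ⟨⟨y ^ k, k, rfl⟩, by rw [mul_comm]; exact h⟩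
  obtain ⟨c, hcK, hc⟩ := exists_mem_Rcirc
    (K := a ^ N ⊔ RingHom.ker (algebraMap R (Localization.Away y))) fun P hP hle => by
      have : P.IsPrime := hP.isPrime
      have haP : a ≤ P := Ideal.IsPrime.le_of_pow_le (le_sup_left.trans hle)
      obtain ⟨b, hb, hk⟩ := exists_notMem_mul_pow_eq_zero hP (hy P hP haP)
      exact hb (hle (Ideal.mem_sup_right ((hker b).mpr hk)))
  obtain ⟨d, hd, b, hb, rfl⟩ := Submodule.mem_sup.mp hcK
  obtain ⟨k, hk⟩ := (hker b).mp hb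
  refine ⟨_, hc, d, hd, k, fun m hm => ?_⟩
  have hbm : b * y ^ m = 0 := by
    rw [← Nat.add_sub_of_le hm, pow_add, ← mul_assoc, hk, zero_mul]
  rw [add_mul, hbm, add_zero]

/-- Powers of an element of the rational power `𝔞ₜ` lie, after multiplication by a fixed element
of `R°`, in the expected powers of `𝔞`. -/
theorem exists_mem_Rcirc_mul_pow_mem_of_mem_ratPow {R : Type*} [CommRing R] [IsNoetherianRing R]
    {a : Ideal R} {t : ℚ} (ht : 0 < t) {y : R} (hy : y ∈ ratPow a t) :
    ∃ c ∈ Rcirc R, ∃ k : ℕ, ∀ m, k ≤ m → c * y ^ m ∈ a ^ ⌈(t : ℝ) * m⌉₊ := by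
  obtain ⟨n, hn⟩ := exists_pow_mem_pow_sub_of_mem_intCl hy
  have hr : 0 < t.num.toNat := by have := Rat.num_pos.mpr ht; omega
  set r := t.num.toNat with hrdef
  have hs : 0 < t.den := t.den_pos
  have htr : (t : ℝ) * t.den = r := by
    have h1 : ((t.num : ℤ) : ℚ) = (r : ℚ) := by
      rw [show t.num = (r : ℤ) by omega]; norm_cast
    have h2 : t * t.den = r := by rw [Rat.mul_den_eq_num, h1]
    exact_mod_cast h2
  obtain ⟨c, hc, d, hd, k, hk⟩ := exists_mem_Rcirc_mul_pow_eq (a := a) (y := y)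
    (fun P hP haP => by
      have : P.IsPrime := hP.isPrime
      have h := hn (n + 1)
      rw [Nat.add_sub_cancel_left, pow_one, ← pow_mul] at h
      exact this.mem_of_pow_mem _ (haP (Ideal.pow_le_self hr.ne' h))) (r * (n + 1))
  refine ⟨c, hc, k, fun m hm => ?_⟩
  rw [hk m hm, ← Nat.div_add_mod m t.den, pow_add, pow_mul]
  have hmem := Ideal.mul_mem_mul hd (hn (m / t.den))
  rw [← pow_mul, ← pow_add] at hmem
  rw [← mul_assoc]
  refine Ideal.mul_mem_right _ _ (Ideal.pow_le_pow_right ?_ hmem)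
  rw [Nat.div_add_mod]
  have hexp : r * (m / t.den + 1) ≤ r * (n + 1) + r * (m / t.den - n) := by
    rw [← Nat.mul_add]
    exact Nat.mul_le_mul_left _ (by omega)
  refine le_trans (Nat.ceil_le.mpr ?_) hexp
  have hlt : (m : ℝ) ≤ t.den * ((m / t.den : ℕ) + 1) := by
    exact_mod_cast (Nat.lt_mul_div_succ m hs).le
  have ht' : (0 : ℝ) ≤ t := by exact_mod_cast ht.le
  calc (t : ℝ) * m ≤ t * (t.den * ((m / t.den : ℕ) + 1)) := by gcongr
    _ = _ := by rw [← mul_assoc, htr]; push_cast; ring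

theorem HY_tight_closure_rational_power {R : Type*} [CommRing R] [IsNoetherianRing R]
    (p : ℕ) [Fact p.Prime] [CharP R p] (I a : Ideal R) (t : ℚ) (ht : 0 < t) :
    HYTightCl p I a (t : ℝ) ⊆ {x | ∀ y ∈ ratPow a t, x * y ∈ tightCl p I} := by
  rintro x ⟨c, hc, E, hx⟩ y hy
  obtain ⟨c', hc', k, hk⟩ := exists_mem_Rcirc_mul_pow_mem_of_mem_ratPow ht hy
  refine ⟨c * c', mul_mem_Rcirc hc hc', max E k, fun e he => ?_⟩
  have hke : k ≤ p ^ e := (le_of_max_le_right he).trans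
    (e.lt_pow_self (Fact.out : p.Prime).one_lt).le
  have h := hx e (le_of_max_le_left he) (c' * y ^ p ^ e) (by simpa using hk _ hke)
  convert h using 1
  ring
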